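/- arXiv:2102.00891 — 2 statements merged into one kernel-verified Lean document; each statement's English description precedes it below -/
import Mathlib

section
/- Let n ≥ 2. If for every complex number q with |q| = R_* one has |𝓕_{n−2}(q)| < R_*^{-1}·|𝓕_n(q)|, then for every complex number q with |q| = R_* one has |𝓕_n(q)| < R_*^{-1}·|𝓕_{n+2}(q)|. -/
open Polynomial

noncomputable def fibPoly : ℕ → Polynomial ℤ
  | 0 => 0
  | 1 => 1
  | (n + 2) =>
    if n % 2 = 0 then fibPoly (n + 1) + X ^ 2 * fibPoly n
    else X * fibPoly (n + 1) + fibPoly n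

/-- `R_* = (3 − √5)/2`. -/
noncomputable def Rstar : ℝ := (3 - Real.sqrt 5) / 2

theorem fibPoly_add_four (n : ℕ) :
    fibPoly (n + 4) = (1 + X + X ^ 2) * fibPoly (n + 2) - X ^ 2 * fibPoly n := by
  have h2 := fibPoly.eq_3 n
  have h3 := fibPoly.eq_3 (n + 1)
  have h4 := fibPoly.eq_3 (n + 2)
  rcases Nat.mod_two_eq_zero_or_one n with h | h
  · rw [if_pos h] at h2
    rw [if_neg (by omega)] at h3
    rw [if_pos (by omega)] at h4
    linear_combination h4 + h3 - h2
  · rw [if_neg (by omega)] at h2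
    rw [if_pos (by omega)] at h3
    rw [if_neg (by omega)] at h4
    linear_combination h4 + X * h3 - X ^ 2 * h2

theorem aeval_fibPoly_add_four (q : ℂ) (n : ℕ) :
    aeval q (fibPoly (n + 4)) =
      (1 + q + q ^ 2) * aeval q (fibPoly (n + 2)) - q ^ 2 * aeval q (fibPoly n) := by
  rw [fibPoly_add_four]
  simp

theorem Rstar_pos : 0 < Rstar := by
  have h : Real.sqrt 5 < 3 := by
    rw [Real.sqrt_lt' (by norm_num)]
    norm_num
  unfold Rstar
  linarith

theorem Rstar_lt_one : Rstar < 1 := by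
  have h : 1 < Real.sqrt 5 := by
    rw [Real.lt_sqrt (by norm_num)]
    norm_num
  unfold Rstar
  linarith

theorem Rstar_sq : Rstar ^ 2 = 3 * Rstar - 1 := by
  have h : Real.sqrt 5 ^ 2 = 5 := Real.sq_sqrt (by norm_num)
  unfold Rstar
  linear_combination h / 4

/-- One step of the Herglotz property of the ratios `q * 𝓕_n(q) / 𝓕_{n+2}(q)`. -/
theorem im_mul_im_step_nonneg {q A B : ℂ} (hq : ‖q‖ ≤ 1)
    (h : 0 ≤ q.im * (q * A * (starRingEnd ℂ) B).im) :
    0 ≤ q.im * (q * B * (starRingEnd ℂ) ((1 + q + q ^ 2) * B - q ^ 2 * A)).im := by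
  have hN : Complex.normSq q ≤ 1 := by
    rw [Complex.normSq_eq_norm_sq]
    exact pow_le_one₀ (norm_nonneg _) hq
  have key : q.im * (q * B * (starRingEnd ℂ) ((1 + q + q ^ 2) * B - q ^ 2 * A)).im =
      q.im ^ 2 * (1 - Complex.normSq q) * Complex.normSq B +
        Complex.normSq q * (q.im * (q * A * (starRingEnd ℂ) B).im) := by
    simp [Complex.normSq_apply, pow_two]
    ring
  rw [key]
  have h1 : 0 ≤ 1 - Complex.normSq q := by linarith
  have h2 := Complex.normSq_nonneg q
  have h3 := Complex.normSq_nonneg B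
  positivity

theorem im_mul_im_fibPoly_nonneg {q : ℂ} (hq : ‖q‖ ≤ 1) (n : ℕ) :
    0 ≤ q.im * (q * aeval q (fibPoly n) * (starRingEnd ℂ) (aeval q (fibPoly (n + 2)))).im := by
  induction n using Nat.strong_induction_on with
  | _ n ih =>
    match n, ih with
    | 0, _ => simp [fibPoly]
    | 1, _ =>
      simp [fibPoly]
      nlinarith [sq_nonneg q.im]
    | n + 2, ih =>
      rw [aeval_fibPoly_add_four]
      exact im_mul_im_step_nonneg hq (ih n (by omega))

theorem one_lt_sq_add_sq_of_unit_circle {a b c s t : ℝ} (ht : t ^ 2 = 5) (ht0 : 0 ≤ t)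
    (hcs : c ^ 2 + s ^ 2 = 1) (hab : a ^ 2 + b ^ 2 < 1) (hsb : 0 ≤ s * b) :
    1 < (1 + 3 * c - a) ^ 2 + (t * s + b) ^ 2 := by
  have him : 5 - 5 * c ^ 2 ≤ (t * s + b) ^ 2 := by
    have : (t * s + b) ^ 2 = 5 - 5 * c ^ 2 + b ^ 2 + 2 * (t * (s * b)) := by
      linear_combination s ^ 2 * ht + 5 * hcs
    rw [this]
    nlinarith [sq_nonneg b, mul_nonneg ht0 hsb]
  have ha : |a| < 1 := by
    rw [← sq_lt_one_iff_abs_lt_one]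
    nlinarith [sq_nonneg b]
  obtain ⟨ha1, ha2⟩ := abs_lt.mp ha
  have hc : -1 ≤ c := by nlinarith [sq_nonneg s]
  rcases le_total c (-2 / 3) with h | h
  · have h1 : (-2 - 3 * c) ^ 2 < (a - 1 - 3 * c) ^ 2 :=
      pow_lt_pow_left₀ (by linarith) (by linarith) two_ne_zero
    nlinarith
  · rcases le_total c 0 with h0 | h0
    · nlinarith [sq_nonneg (1 + 3 * c - a)]
    · nlinarith

theorem Rstar_lt_norm_of_norm_lt_one {q m : ℂ} (hq : ‖q‖ = Rstar) (hm : ‖m‖ < 1)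
    (him : 0 ≤ q.im * m.im) : Rstar < ‖1 + q + q ^ 2 - q * m‖ := by
  have hR := Rstar_pos
  have hR2 := Rstar_sq
  have ht : Real.sqrt 5 ^ 2 = 5 := Real.sq_sqrt (by norm_num)
  have hts : Real.sqrt 5 = 3 - 2 * Rstar := by unfold Rstar; ring
  have hx : q.re ^ 2 + q.im ^ 2 = Rstar ^ 2 := by
    rw [← hq, ← Complex.normSq_eq_norm_sq, Complex.normSq_apply]
    ring
  have hab : m.re ^ 2 + m.im ^ 2 < 1 := by
    have h1 := pow_lt_one₀ (norm_nonneg m) hm two_ne_zero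
    rw [← Complex.normSq_eq_norm_sq, Complex.normSq_apply] at h1
    linarith
  have hcs : (q.re / Rstar) ^ 2 + (q.im / Rstar) ^ 2 = 1 := by
    field_simp
    linarith
  have hsb : 0 ≤ q.im / Rstar * m.im := by
    rw [div_mul_eq_mul_div]
    positivity
  have key := one_lt_sq_add_sq_of_unit_circle ht (Real.sqrt_nonneg 5) hcs hab hsb
  have hw : 1 + q + q ^ 2 - q * m = q * ⟨1 + 3 * (q.re / Rstar) - m.re,
      -(Real.sqrt 5 * (q.im / Rstar) + m.im)⟩ := by
    have hinv : Rstar⁻¹ = 3 - Rstar := by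
      field_simp
      linarith
    simp only [div_eq_mul_inv, hinv, hts]
    apply Complex.ext
    · simp [pow_two]
      linear_combination (3 * Rstar - 8) * hx + (3 * Rstar + 1 - 2 * q.im ^ 2) * hR2
    · simp [pow_two]
      linear_combination (2 * q.im * q.re) * hR2
  rw [hw, norm_mul, hq]
  refine lt_mul_of_one_lt_right hR ?_
  rw [← one_lt_sq_iff₀ (norm_nonneg _), ← Complex.normSq_eq_norm_sq, Complex.normSq_apply]
  linarith

theorem fibPoly_ratio_induction_step (n : ℕ) (hn : 2 ≤ n)
    (h : ∀ q : ℂ, ‖q‖ = Rstar →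
      ‖aeval q (fibPoly (n - 2))‖ < Rstar⁻¹ * ‖aeval q (fibPoly n)‖) :
    ∀ q : ℂ, ‖q‖ = Rstar →
      ‖aeval q (fibPoly n)‖ < Rstar⁻¹ * ‖aeval q (fibPoly (n + 2))‖ := by
  intro q hq
  obtain ⟨k, rfl⟩ := Nat.exists_eq_add_of_le' hn
  have hR := Rstar_pos
  have hlt := h q hq
  rw [Nat.add_sub_cancel] at hlt
  have him := im_mul_im_fibPoly_nonneg (hq.le.trans Rstar_lt_one.le) k
  rw [aeval_fibPoly_add_four]
  generalize aeval q (fibPoly k) = A at *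
  generalize aeval q (fibPoly (k + 2)) = B at *
  have hB : B ≠ 0 := by
    rintro rfl
    simp only [norm_zero, mul_zero] at hlt
    exact absurd hlt (norm_nonneg A).not_gt
  have hB' : 0 < ‖B‖ := norm_pos_iff.mpr hB
  have hm : ‖q * A / B‖ < 1 := by
    rw [norm_div, norm_mul, hq, div_lt_one hB']
    rwa [lt_inv_mul_iff₀ hR] at hlt
  have hmim : 0 ≤ q.im * (q * A / B).im := by
    have : q * A / B = ((Complex.normSq B)⁻¹ : ℝ) * (q * A * (starRingEnd ℂ) B) := by
      rw [div_eq_mul_inv, Complex.inv_def]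
      ring
    rw [this, Complex.im_ofReal_mul, mul_left_comm]
    exact mul_nonneg (inv_nonneg.mpr (Complex.normSq_nonneg B)) him
  have hfac : (1 + q + q ^ 2) * B - q ^ 2 * A = (1 + q + q ^ 2 - q * (q * A / B)) * B := by
    field_simp
  rw [hfac, norm_mul, lt_inv_mul_iff₀ hR]
  exact mul_lt_mul_of_pos_right (Rstar_lt_norm_of_norm_lt_one hq hm hmim) hB'
end

section
/- For every n ≥ 1, every complex root q_r of the Pell polynomial 𝓟_n satisfies R_{√2} < |q_r| < R_{√2}^{-1}, and the same bounds hold for every complex root of the reversed polynomial q^{2n−3}·𝓟_n(1/q) when n ≥ 2. -/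
open Polynomial

noncomputable def pellPoly : ℕ → Polynomial ℤ
  | 0 => 0
  | 1 => 1
  | (n + 2) =>
    if n % 2 = 0 then (1 + X) * pellPoly (n + 1) + X ^ 4 * pellPoly n
    else (X + X ^ 2) * pellPoly (n + 1) + pellPoly n

/-- `R_{√2} = (1 + √2 − √(2√2 − 1))/2`. -/
noncomputable def Rsqrt2 : ℝ := (1 + Real.sqrt 2 - Real.sqrt (2 * Real.sqrt 2 - 1)) / 2

/-- The polar form of a nonzero complex number together with that of its inverse. -/
lemma exists_polar_coords {q : ℂ} (hq : q ≠ 0) :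
    ∃ κ c σ : ℝ, ‖q‖ * κ = 1 ∧ c ^ 2 + σ ^ 2 = 1 ∧
      q = ⟨‖q‖ * c, ‖q‖ * σ⟩ ∧ q⁻¹ = ⟨κ * c, -(κ * σ)⟩ := by
  have h0 : ‖q‖ ≠ 0 := norm_ne_zero_iff.2 hq
  have h1 : q.re ^ 2 + q.im ^ 2 = ‖q‖ ^ 2 := by
    rw [Complex.sq_norm, Complex.normSq_apply]; ring
  refine ⟨‖q‖⁻¹, q.re / ‖q‖, q.im / ‖q‖, mul_inv_cancel₀ h0, ?_, ?_, ?_⟩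
  · field_simp; exact h1
  · apply Complex.ext <;> simp <;> field_simp
  · apply Complex.ext
    · simp only [Complex.inv_re, Complex.normSq_eq_norm_sq]; field_simp
    · simp only [Complex.inv_im, Complex.normSq_eq_norm_sq]; field_simp

/-- The trace of the two-step transfer matrix of the Pell recurrence, divided by `q ^ 2`. -/
noncomputable def pellTrace (q : ℂ) : ℂ := q ^ 2 + q⁻¹ ^ 2 + q + q⁻¹ + 2

lemma pellTrace_inv (q : ℂ) : pellTrace q⁻¹ = pellTrace q := by
  simp only [pellTrace, inv_inv]; ring

section RealInequalities

variable {ρ κ c σ : ℝ}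

lemma sum_inv_bounds (hm : 1 + √2 ≤ ρ + κ) :
    2.414 ≤ ρ + κ ∧ 6 * (ρ + κ) ^ 2 ≤ (ρ + κ) ^ 4 + 1 := by
  have h2 : √2 ^ 2 = 2 := Real.sq_sqrt (by norm_num)
  have h1 : (1.414 : ℝ) ≤ √2 := Real.le_sqrt_of_sq_le (by norm_num)
  refine ⟨by linarith, ?_⟩
  have h3 : 3 + 2 * √2 ≤ (ρ + κ) ^ 2 := by nlinarith
  nlinarith

/-- With `q = ρ * (c + σ * I)` and `|s| + t < 2`, the trace of `q` is not `s + t * q ^ 2`. -/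
lemma no_real_trace_shift (hρ : 0 < ρ) (hρ1 : ρ ≤ 0.55) (hκ : ρ * κ = 1)
    (hc : c ^ 2 + σ ^ 2 = 1) (hm : 1 + √2 ≤ ρ + κ) {s t : ℝ} (ht : 0 ≤ t) (ht1 : t ≤ 1)
    (hs : |s| + t < 2)
    (hre : (2 * c ^ 2 - 1) * (ρ ^ 2 + κ ^ 2) + c * (ρ + κ) + 2 =
      s + t * (ρ ^ 2 * (2 * c ^ 2 - 1)))
    (him : σ * (2 * c * (ρ ^ 2 - κ ^ 2) + (ρ - κ)) = t * (ρ ^ 2 * (2 * c * σ))) : False := by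
  obtain ⟨h1, h2⟩ := sum_inv_bounds hm
  set m := ρ + κ with hmdef
  have hsq : ρ ^ 2 + κ ^ 2 = m ^ 2 - 2 := by rw [hmdef]; linear_combination -2 * hκ
  have hρ2 : ρ ^ 2 ≤ 0.3025 := by nlinarith
  rcases eq_or_ne σ 0 with h0 | h0
  · have hc1 : c ^ 2 = 1 := by rw [h0] at hc; linarith
    have e1 : -m ≤ c * m := by nlinarith
    have e2 : t * ρ ^ 2 ≤ t := mul_le_of_le_one_right ht (by linarith)
    have e3 : 3 < m ^ 2 - m := by nlinarith
    rw [hsq, hc1] at hre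
    linarith [le_abs_self s]
  · have him' : 2 * c * (m * (κ - ρ) + t * ρ ^ 2) = -(κ - ρ) := by
      apply mul_left_cancel₀ h0
      rw [hmdef]; linear_combination -him
    have hd : 1.3 ≤ κ - ρ := by linarith
    have htρ : 0 ≤ t * ρ ^ 2 := by positivity
    have htρ' : t * ρ ^ 2 ≤ t * 0.3025 := mul_le_mul_of_nonneg_left hρ2 ht
    have hmd : 0 < m * (κ - ρ) := mul_pos (by linarith) (by linarith)
    have hc0 : c < 0 := by
      by_contra hcn
      have := mul_nonneg (not_lt.1 hcn) (add_nonneg hmd.le htρ)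
      linarith
    have hlin : (κ - ρ) * (2 * (c * m) + 1) = 2 * (-c * (t * ρ ^ 2)) := by
      linear_combination him'
    have hcm : 0 ≤ 2 * (c * m) + 1 := by
      have e1 := mul_nonneg (neg_pos.2 hc0).le htρ
      exact nonneg_of_mul_nonneg_right (by linarith) (by linarith : 0 < κ - ρ)
    have hc4 : -(1 / 4) ≤ c := by
      have := mul_nonneg_of_nonpos_of_nonpos hc0.le (by linarith : 2 - m ≤ 0)
      linarith
    have hcm2 : 2 * (c * m) + 1 ≤ t / 4 := by
      have e1 := mul_le_mul_of_nonneg_right hd hcm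
      have e2 := mul_nonneg (by linarith : 0 ≤ c + 1 / 4) htρ
      linarith
    have hc2 : c ^ 2 * m ^ 2 ≤ 1 / 4 := by
      have : 0 < -(c * m) := by
        have := mul_pos (neg_pos.2 hc0) (by linarith : 0 < m)
        linarith
      rw [← mul_pow, ← neg_sq]
      exact (pow_le_pow_left₀ this.le (by linarith : -(c * m) ≤ 1 / 2) 2).trans (by norm_num)
    have key : 0 ≤ m ^ 2 - 6 + 4 * c ^ 2 - 2 * (c ^ 2 * m ^ 2) + 1 / 2 := by
      have hm2 : 5.8 ≤ m ^ 2 := by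
        have := pow_le_pow_left₀ (by norm_num) h1 2
        linarith
      have e1 := mul_nonneg (sub_nonneg.2 hc2) (by linarith : 0 ≤ 2 * m ^ 2 - 4)
      have e2 : 0 ≤ m ^ 2 * (m ^ 2 - 6 + 4 * c ^ 2 - 2 * (c ^ 2 * m ^ 2) + 1 / 2) := by
        linarith
      exact nonneg_of_mul_nonneg_right e2 (by linarith)
    rw [hsq] at hre
    have e1 := mul_nonneg htρ (sq_nonneg c)
    have e2 := neg_abs_le s
    linarith

lemma one_lt_cubic {k : ℝ} (hk : 0.35 ≤ k) (hk' : k ≤ 0.91) :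
    1 < (1 - k ^ 2) * (1.827 * (4.828 * k - 1)) := by
  nlinarith [mul_nonneg (sub_nonneg.2 hk) (sub_nonneg.2 hk')]

/-- With `q = ρ * (c + σ * I)`, `w` its trace and `h = w - q⁻¹ ^ 2`, there are no `|s| < 2` and
`τ ≥ 0` such that `τ * ‖h‖ ^ 2 ≤ 1` and `w` equals `s` plus `τ` times the conjugate of `h`. -/
lemma no_real_trace_conj (hρ : 0 < ρ) (hρ1 : ρ ≤ 0.5315) (hκ : ρ * κ = 1)
    (hc : c ^ 2 + σ ^ 2 = 1) (hm : 1 + √2 ≤ ρ + κ) {s τ : ℝ} (hτ : 0 ≤ τ)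
    (hs : |s| < 2)
    (hre : (2 * c ^ 2 - 1) * (ρ ^ 2 + κ ^ 2) + c * (ρ + κ) + 2 =
      s + τ * (c * (ρ + κ) + 2 + (2 * c ^ 2 - 1) * ρ ^ 2))
    (him : σ * (2 * c * (ρ ^ 2 - κ ^ 2) + (ρ - κ)) =
      -(τ * (σ * (2 * c * ρ ^ 2 + (ρ - κ)))))
    (hn : τ * ((c * (ρ + κ) + 2 + (2 * c ^ 2 - 1) * ρ ^ 2) ^ 2 +
      (σ * (2 * c * ρ ^ 2 + (ρ - κ))) ^ 2) ≤ 1) : False := by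
  obtain ⟨h1, h2⟩ := sum_inv_bounds hm
  obtain ⟨hs1, hs2⟩ := abs_lt.1 hs
  set m := ρ + κ with hmdef
  have hm2 : 5.827 ≤ m ^ 2 := by
    have := pow_le_pow_left₀ (by norm_num) h1 2
    linarith
  have hmm : 2.414 * m ≤ m ^ 2 := by
    rw [sq]; exact mul_le_mul_of_nonneg_right h1 (by linarith)
  have hsq : ρ ^ 2 + κ ^ 2 = m ^ 2 - 2 := by rw [hmdef]; linear_combination -2 * hκ
  have hρ2 : ρ ^ 2 ≤ 0.2825 :=
    (pow_le_pow_left₀ hρ.le hρ1 2).trans (by norm_num)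
  have hρ20 : 0 < ρ ^ 2 := by positivity
  have hd2 : (κ - ρ) ^ 2 = m ^ 2 - 4 := by rw [hmdef]; linear_combination -4 * hκ
  have hd : 1.351 ≤ κ - ρ := by linarith
  rw [hsq] at hre
  rcases eq_or_ne σ 0 with h0 | h0
  · have hc1 : c ^ 2 = 1 := by rw [h0] at hc; linarith
    have hw : 0 < m ^ 2 - m - 2 := by linarith
    rcases (sq_eq_sq_iff_eq_or_eq_neg.1 (hc1.trans (one_pow 2).symm)) with rfl | rfl
    · have e1 : 1 ≤ τ * (1 * m + 2 + (2 * 1 ^ 2 - 1) * ρ ^ 2) := by linarith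
      have e2 := mul_le_mul_of_nonneg_right e1
        (by linarith : 0 ≤ 1 * m + 2 + (2 * 1 ^ 2 - 1) * ρ ^ 2)
      rw [h0] at hn
      linarith
    · have := mul_nonneg hτ (by linarith : 0 ≤ m - 2 - ρ ^ 2)
      linarith
  · set d := κ - ρ with hddef
    obtain ⟨k, rfl⟩ : ∃ k, c = -k := ⟨-c, by ring⟩
    have him' : τ * (d + 2 * k * ρ ^ 2) = d * (2 * k * m - 1) := by
      apply mul_left_cancel₀ h0
      rw [hmdef, hddef]; linear_combination -him
    obtain ⟨hkm1, hk1⟩ := abs_le.1 ((sq_le_one_iff_abs_le_one k).1 (by linarith [sq_nonneg σ]))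
    have hH : 0 < d + 2 * k * ρ ^ 2 := by
      have := mul_nonneg (by linarith : 0 ≤ k + 1) hρ20.le
      linarith
    have hj : 1 / 2 ≤ k * m := by
      have : 0 ≤ d * (2 * k * m - 1) := him' ▸ mul_nonneg hτ hH.le
      have := nonneg_of_mul_nonneg_right this (by linarith : 0 < d)
      linarith
    have hk0 : 0 < k := by
      by_contra hkn
      have := mul_nonneg (neg_nonneg.2 (not_lt.1 hkn)) (by linarith : 0 ≤ m)
      linarith
    have hE : (1 - k ^ 2) * (d ^ 2 * (2 * k * m - 1)) ≤ 1 := by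
      have e1 : τ * (σ * (2 * (-k) * ρ ^ 2 + (ρ - κ))) ^ 2 =
          σ ^ 2 * (d + 2 * k * ρ ^ 2) * (d * (2 * k * m - 1)) := by
        rw [← him', hddef]; ring
      have e2 : τ * (σ * (2 * (-k) * ρ ^ 2 + (ρ - κ))) ^ 2 ≤ 1 := by
        have := mul_nonneg hτ (sq_nonneg (-k * m + 2 + (2 * (-k) ^ 2 - 1) * ρ ^ 2))
        linarith
      rw [e1] at e2
      have e3 : σ ^ 2 = 1 - k ^ 2 := by linarith
      rw [e3] at e2
      have e4 : 0 ≤ (1 - k ^ 2) * (2 * k * ρ ^ 2) * (d * (2 * k * m - 1)) := by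
        rw [← e3]
        have : 0 ≤ 2 * k * m - 1 := by linarith
        positivity
      linarith
    rcases le_total k 0.91 with hk | hk
    · have hd2' : 1.827 ≤ d ^ 2 := by linarith
      rcases le_total k 0.35 with hk' | hk'
      · have hb : 0.8775 * (d ^ 2 * (2 * k * m - 1)) ≤ 1 := by
          have : 0 ≤ d ^ 2 * (2 * k * m - 1) := mul_nonneg (sq_nonneg _) (by linarith)
          have := mul_nonneg this (by linarith [pow_le_pow_left₀ hk0.le hk' 2] :
            0 ≤ 1 - k ^ 2 - 0.8775)
          linarith
        set j := k * m with hjdef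
        have hjb : j ≤ 0.812 := by
          have := mul_le_mul_of_nonneg_right hd2' (by linarith : 0 ≤ 2 * j - 1)
          have e0 : d ^ 2 * (2 * k * m - 1) = d ^ 2 * (2 * j - 1) := by rw [hjdef]; ring
          linarith
        have hτ1 : 0.87 * (2 * j - 1) ≤ τ := by
          have e1 : k * ρ ^ 2 ≤ 0.1 := by
            have := mul_le_mul hk' hρ2 hρ20.le (by norm_num)
            linarith
          have e2 := mul_le_mul_of_nonneg_left (by linarith : d + 2 * k * ρ ^ 2 ≤ d * 1.149) hτ
          have e3 : d * (2 * j - 1) ≤ d * (τ * 1.149) := by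
            rw [hjdef]; linarith
          have := le_of_mul_le_mul_left e3 (by linarith)
          linarith
        have hh : 0.9 ≤ -k * m + 2 + (2 * (-k) ^ 2 - 1) * ρ ^ 2 := by
          have := mul_nonneg hρ20.le (sq_nonneg k)
          linarith
        have hp : 0.9 * (0.87 * (2 * j - 1)) ≤
            τ * (-k * m + 2 + (2 * (-k) ^ 2 - 1) * ρ ^ 2) := by
          rw [mul_comm]
          apply mul_le_mul hτ1 hh (by norm_num) hτ
        have hF : (2 * (-k) ^ 2 - 1) * (m ^ 2 - 2) + -k * m + 4
            = 6 - m ^ 2 - j + 2 * j ^ 2 - 4 * k ^ 2 := by rw [hjdef]; ring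
        have e1 : 1.566 * (j - 1 / 2) < 6 - m ^ 2 - j + 2 * j ^ 2 - 4 * k ^ 2 := by linarith
        have e2 := mul_lt_mul_of_pos_left e1 (by linarith : 0 < m ^ 2)
        have hkj : k ^ 2 * m ^ 2 = j ^ 2 := by rw [hjdef]; ring
        rw [hd2] at hb
        have e3 : 0 ≤ 2.566 * m ^ 2 - (2 * m ^ 2 - 4) * (j + 1 / 2) := by linarith
        have e4 := mul_nonneg e3 (by linarith : 0 ≤ j - 1 / 2)
        linarith
      · have e1 := one_lt_cubic hk' hk
        have e2 := mul_le_mul_of_nonneg_left h1 hk0.le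
        have e3 : 1.827 * (4.828 * k - 1) ≤ d ^ 2 * (2 * k * m - 1) :=
          mul_le_mul hd2' (by linarith) (by linarith) (sq_nonneg d)
        have e4 := mul_le_mul_of_nonneg_left e3 (by linarith [sq_nonneg σ] : 0 ≤ 1 - k ^ 2)
        linarith
    · have hh : -k * m + 2 + (2 * (-k) ^ 2 - 1) * ρ ^ 2 ≤ 0 := by
        have e2 : 2 * (-k) ^ 2 - 1 ≤ 3.82 * k - 2.82 := by
          linarith [mul_nonneg (sub_nonneg.2 hk1) (sub_nonneg.2 hk)]
        have e3 := mul_le_mul e2 hρ2 hρ20.le (by linarith)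
        have e4 := mul_le_mul_of_nonneg_left h1 hk0.le
        linarith
      have hw : 2 ≤ (2 * (-k) ^ 2 - 1) * (m ^ 2 - 2) + -k * m + 2 := by
        have e1 : 0.65 ≤ 2 * (-k) ^ 2 - 1 := by
          linarith [pow_le_pow_left₀ (by norm_num) hk 2]
        have e2 : 0 ≤ 0.65 * (m ^ 2 - 2) - m := by linarith
        have e3 := mul_le_mul_of_nonneg_right e1 (by linarith : 0 ≤ m ^ 2 - 2)
        have e4 := mul_le_mul_of_nonneg_right hk1 (by linarith : 0 ≤ m)
        linarith
      have := mul_nonneg hτ (neg_nonneg.2 hh)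
      linarith

end RealInequalities

lemma Rsqrt2_pos : 0 < Rsqrt2 := by
  have h2 : √2 ^ 2 = 2 := Real.sq_sqrt (by norm_num)
  have : √(2 * √2 - 1) < 1 + √2 := by
    rw [Real.sqrt_lt' (by positivity)]
    nlinarith
  unfold Rsqrt2
  linarith

lemma Rsqrt2_le : Rsqrt2 ≤ 0.5315 := by
  have h1 : (1.414 : ℝ) ≤ √2 := Real.le_sqrt_of_sq_le (by norm_num)
  have h2 : √2 ≤ 1.41422 := Real.sqrt_le_iff.2 (by norm_num)
  have h3 : (1.352 : ℝ) ≤ √(2 * √2 - 1) := Real.le_sqrt_of_sq_le (by norm_num at *; linarith)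
  unfold Rsqrt2
  linarith

lemma Rsqrt2_quadratic : Rsqrt2 ^ 2 - (1 + √2) * Rsqrt2 + 1 = 0 := by
  have h1 : (1 : ℝ) ≤ √2 := Real.one_le_sqrt.2 (by norm_num)
  have h2 : √2 ^ 2 = 2 := Real.sq_sqrt (by norm_num)
  have h3 : √(2 * √2 - 1) ^ 2 = 2 * √2 - 1 := Real.sq_sqrt (by linarith)
  unfold Rsqrt2
  linear_combination h3 / 4 - h2 / 4

lemma one_add_sqrt_two_le {ρ κ : ℝ} (hρ : 0 < ρ) (hκ : ρ * κ = 1) (hR : ρ ≤ Rsqrt2) :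
    1 + √2 ≤ ρ + κ := by
  have h1 : (1.414 : ℝ) ≤ √2 := Real.le_sqrt_of_sq_le (by norm_num)
  have h2 := Rsqrt2_le
  have h3 := mul_nonneg (sub_nonneg.2 hR) (by linarith : 0 ≤ 1 + √2 - Rsqrt2 - ρ)
  have h4 : 0 ≤ ρ * (ρ + κ - (1 + √2)) := by
    linarith [Rsqrt2_quadratic]
  linarith [nonneg_of_mul_nonneg_right h4 hρ]

/-- Real and imaginary parts of the quantities attached to `q` in polar coordinates. -/
lemma exists_polar_trace {q : ℂ} (hq : q ≠ 0) :
    ∃ κ c σ : ℝ, ‖q‖ * κ = 1 ∧ c ^ 2 + σ ^ 2 = 1 ∧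
      (q ^ 2).re = ‖q‖ ^ 2 * (2 * c ^ 2 - 1) ∧ (q ^ 2).im = ‖q‖ ^ 2 * (2 * c * σ) ∧
      (pellTrace q).re = (2 * c ^ 2 - 1) * (‖q‖ ^ 2 + κ ^ 2) + c * (‖q‖ + κ) + 2 ∧
      (pellTrace q).im = σ * (2 * c * (‖q‖ ^ 2 - κ ^ 2) + (‖q‖ - κ)) ∧
      (pellTrace q - q⁻¹ ^ 2).re = c * (‖q‖ + κ) + 2 + (2 * c ^ 2 - 1) * ‖q‖ ^ 2 ∧
      (pellTrace q - q⁻¹ ^ 2).im = σ * (2 * c * ‖q‖ ^ 2 + (‖q‖ - κ)) := by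
  obtain ⟨κ, c, σ, hκ, hc, h1, h2⟩ := exists_polar_coords hq
  have r1 : q.re = ‖q‖ * c := congrArg Complex.re h1
  have i1 : q.im = ‖q‖ * σ := congrArg Complex.im h1
  have r2 : (q⁻¹).re = κ * c := congrArg Complex.re h2
  have i2 : (q⁻¹).im = -(κ * σ) := congrArg Complex.im h2
  have hσ : σ ^ 2 = 1 - c ^ 2 := by linarith
  have rq : (q ^ 2).re = ‖q‖ ^ 2 * (2 * c ^ 2 - 1) := by
    rw [pow_two, Complex.mul_re, r1, i1]; linear_combination -‖q‖ ^ 2 * hσ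
  have iq : (q ^ 2).im = ‖q‖ ^ 2 * (2 * c * σ) := by
    rw [pow_two, Complex.mul_im, r1, i1]; ring
  have rqi : (q⁻¹ ^ 2).re = κ ^ 2 * (2 * c ^ 2 - 1) := by
    rw [pow_two, Complex.mul_re, r2, i2]; linear_combination -κ ^ 2 * hσ
  have iqi : (q⁻¹ ^ 2).im = -(κ ^ 2 * (2 * c * σ)) := by
    rw [pow_two, Complex.mul_im, r2, i2]; ring
  refine ⟨κ, c, σ, hκ, hc, rq, iq, ?_, ?_, ?_, ?_⟩ <;>
    simp only [pellTrace, Complex.add_re, Complex.add_im, Complex.sub_re, Complex.sub_im, rq, iq,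
      rqi, iqi, r1, i1, r2, i2, Complex.re_ofNat, Complex.im_ofNat] <;> ring

lemma pellTrace_mul_ne_add_sq {q : ℂ} (hq : q ≠ 0) (hR : ‖q‖ ≤ Rsqrt2)
    {S C T : ℝ} (hT : 0 ≤ T) (hTS : T ≤ S) (hC : |C| + T < 2 * S) :
    pellTrace q * S ≠ C + q ^ 2 * T := by
  intro h
  obtain ⟨κ, c, σ, hκ, hc, rq, iq, rt, it, -, -⟩ := exists_polar_trace hq
  have hρ : 0 < ‖q‖ := norm_pos_iff.2 hq
  have hS : 0 < S := by linarith [abs_nonneg C]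
  have hre := congrArg Complex.re h
  have him := congrArg Complex.im h
  simp only [Complex.re_mul_ofReal, Complex.im_mul_ofReal, Complex.add_re, Complex.add_im,
    Complex.ofReal_re, Complex.ofReal_im, zero_add, rq, iq, rt, it] at hre him
  refine no_real_trace_shift (s := C / S) (t := T / S) hρ (by linarith [Rsqrt2_le]) hκ hc
    (one_add_sqrt_two_le hρ hκ hR) (by positivity) (div_le_one_of_le₀ hTS hS.le) ?_ ?_ ?_
  · rw [abs_div, abs_of_pos hS, ← add_div, div_lt_iff₀ hS]; exact hC
  · field_simp; linarith
  · field_simp; linarith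

open ComplexConjugate in
lemma pellTrace_mul_ne_add_conj {q : ℂ} (hq : q ≠ 0) (hR : ‖q‖ ≤ Rsqrt2)
    {S C T : ℝ} (hT : 0 ≤ T) (hC : |C| < 2 * S)
    (hTS : Complex.normSq (pellTrace q - q⁻¹ ^ 2) * T ≤ S) :
    pellTrace q * S ≠ C + conj (pellTrace q - q⁻¹ ^ 2) * T := by
  intro h
  obtain ⟨κ, c, σ, hκ, hc, -, -, rt, it, rh, ih⟩ := exists_polar_trace hq
  have hρ : 0 < ‖q‖ := norm_pos_iff.2 hq
  have hS : 0 < S := by linarith [abs_nonneg C]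
  have hre := congrArg Complex.re h
  have him := congrArg Complex.im h
  rw [Complex.normSq_apply, rh, ih] at hTS
  simp only [Complex.re_mul_ofReal, Complex.im_mul_ofReal, Complex.add_re, Complex.add_im,
    Complex.ofReal_re, Complex.ofReal_im, zero_add, Complex.conj_re, Complex.conj_im,
    rh, ih, rt, it] at hre him
  refine no_real_trace_conj (s := C / S) (τ := T / S) hρ (by linarith [Rsqrt2_le]) hκ hc
    (one_add_sqrt_two_le hρ hκ hR) (by positivity) ?_ ?_ ?_ ?_
  · rw [abs_div, abs_of_pos hS, div_lt_iff₀ hS]; exact hC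
  · field_simp; linarith
  · field_simp; linarith
  · rw [div_mul_eq_mul_div, div_le_one hS]; linarith

lemma pellTrace_ne_inv_sq {q : ℂ} (hq : q ≠ 0) (hR : ‖q‖ ≤ Rsqrt2) :
    pellTrace q ≠ q⁻¹ ^ 2 := by
  intro h
  obtain ⟨κ, c, σ, hκ, hc, -, -, -, -, rh, ih⟩ := exists_polar_trace hq
  have hρ : 0 < ‖q‖ := norm_pos_iff.2 hq
  have hρ1 : ‖q‖ ≤ 0.5315 := hR.trans Rsqrt2_le
  have hm := (sum_inv_bounds (one_add_sqrt_two_le hρ hκ hR)).1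
  rw [h, sub_self, Complex.zero_re] at rh
  rw [h, sub_self, Complex.zero_im] at ih
  have hρ2 : ‖q‖ ^ 2 ≤ 0.2825 := (pow_le_pow_left₀ hρ.le hρ1 2).trans (by norm_num)
  have hc1 : c ≤ 1 := (abs_le.1 ((sq_le_one_iff_abs_le_one c).1 (by linarith [sq_nonneg σ]))).2
  have hcρ := mul_le_mul_of_nonneg_right hc1 (sq_nonneg ‖q‖)
  have hσ : σ = 0 := by
    refine (mul_eq_zero.1 ih.symm).resolve_right (ne_of_lt ?_)
    linarith
  rw [hσ] at hc
  have hc2 : c ^ 2 = 1 ^ 2 := by linarith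
  rcases sq_eq_sq_iff_eq_or_eq_neg.1 hc2 with rfl | rfl
  · linarith [sq_nonneg ‖q‖]
  · linarith

/-- The solution of `v (n + 2) = w * v (n + 1) - v n` with `v 0 = 0` and `v 1 = 1`. -/
noncomputable def chebyshevSeq (w : ℂ) : ℕ → ℂ
  | 0 => 0
  | 1 => 1
  | (n + 2) => w * chebyshevSeq w (n + 1) - chebyshevSeq w n

lemma chebyshevSeq_add_two (w : ℂ) (n : ℕ) :
    chebyshevSeq w (n + 2) = w * chebyshevSeq w (n + 1) - chebyshevSeq w n := by
  rw [chebyshevSeq]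

open ComplexConjugate in
/-- The energy identity, obtained by multiplying the recurrence by the conjugate of its solution
and summing. Here `S` is the sum of the squared moduli. -/
lemma exists_chebyshevSeq_energy (w : ℂ) (n : ℕ) :
    ∃ S C : ℝ, w * S = C + chebyshevSeq w (n + 2) * conj (chebyshevSeq w (n + 1)) ∧
      |C| + Complex.normSq (chebyshevSeq w (n + 1)) + 1 ≤ 2 * S ∧
      Complex.normSq (chebyshevSeq w (n + 1)) ≤ S := by
  induction n with
  | zero => exact ⟨1, 0, by simp [chebyshevSeq], by norm_num [chebyshevSeq], by simp [chebyshevSeq]⟩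
  | succ n ih =>
    obtain ⟨S, C, h1, h2, h3⟩ := ih
    have hrec := chebyshevSeq_add_two w (n + 1)
    rw [show n + 1 + 2 = n + 3 from rfl, show n + 1 + 1 = n + 2 from rfl] at *
    set a := chebyshevSeq w (n + 1)
    set b := chebyshevSeq w (n + 2)
    have hb := Complex.mul_conj b
    have hab := Complex.add_conj (b * conj a)
    rw [map_mul, Complex.conj_conj] at hab
    have hN : |2 * (b * conj a).re| ≤ Complex.normSq a + Complex.normSq b := by
      simp only [Complex.mul_re, Complex.conj_re, Complex.conj_im, Complex.normSq_apply]
      rw [abs_le]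
      constructor
      · linarith [sq_nonneg (a.re + b.re), sq_nonneg (a.im + b.im)]
      · linarith [sq_nonneg (a.re - b.re), sq_nonneg (a.im - b.im)]
    refine ⟨S + Complex.normSq b, C + 2 * (b * conj a).re, ?_, ?_, ?_⟩
    · push_cast at hab ⊢
      rw [hrec, ← hab, ← hb]
      linear_combination h1
    · linarith [abs_add_le C (2 * (b * conj a).re)]
    · linarith [Complex.normSq_nonneg a]

lemma chebyshevSeq_pellTrace_ne_zero {q : ℂ} (hq : q ≠ 0) (hR : ‖q‖ ≤ Rsqrt2)
    (n : ℕ) : chebyshevSeq (pellTrace q) (n + 1) ≠ 0 := by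
  intro h
  rcases n with _ | n
  · simp [chebyshevSeq] at h
  · obtain ⟨S, C, h1, h2, h3⟩ := exists_chebyshevSeq_energy (pellTrace q) n
    have := Complex.normSq_nonneg (chebyshevSeq (pellTrace q) (n + 1))
    apply pellTrace_mul_ne_add_sq hq hR (S := S) (C := C) le_rfl (by linarith) (by linarith)
    rw [h1, h]
    simp

lemma chebyshevSeq_pellTrace_ne_sq_mul {q : ℂ} (hq : q ≠ 0) (hR : ‖q‖ ≤ Rsqrt2)
    (n : ℕ) :
    chebyshevSeq (pellTrace q) (n + 2) ≠ q ^ 2 * chebyshevSeq (pellTrace q) (n + 1) := by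
  intro h
  obtain ⟨S, C, h1, h2, h3⟩ := exists_chebyshevSeq_energy (pellTrace q) n
  apply pellTrace_mul_ne_add_sq hq hR (Complex.normSq_nonneg _) h3 (by linarith)
  rw [h1, h, mul_assoc, Complex.mul_conj]

lemma chebyshevSeq_pellTrace_ne_inv_sq_mul {q : ℂ} (hq : q ≠ 0)
    (hR : ‖q‖ ≤ Rsqrt2) (n : ℕ) :
    chebyshevSeq (pellTrace q) (n + 2) ≠ q⁻¹ ^ 2 * chebyshevSeq (pellTrace q) (n + 1) := by
  intro h
  rcases n with _ | n
  · apply pellTrace_ne_inv_sq hq hR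
    simpa [chebyshevSeq] using h
  · obtain ⟨S, C, h1, h2, h3⟩ := exists_chebyshevSeq_energy (pellTrace q) n
    have hrec := chebyshevSeq_add_two (pellTrace q) (n + 1)
    have ha : chebyshevSeq (pellTrace q) (n + 1) =
        (pellTrace q - q⁻¹ ^ 2) * chebyshevSeq (pellTrace q) (n + 2) := by
      linear_combination hrec - h
    have hn := Complex.normSq_nonneg (chebyshevSeq (pellTrace q) (n + 1))
    rw [ha, Complex.normSq_mul] at h3
    apply pellTrace_mul_ne_add_conj hq hR (Complex.normSq_nonneg _) (by linarith) h3
    rw [h1, ha, map_mul, ← Complex.mul_conj]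
    ring

lemma pellPoly_even_add_two (l : ℕ) :
    pellPoly (2 * l + 2) = (1 + X) * pellPoly (2 * l + 1) + X ^ 4 * pellPoly (2 * l) := by
  rw [pellPoly, if_pos (by omega)]

lemma pellPoly_odd_add_two (l : ℕ) :
    pellPoly (2 * l + 3) = (X + X ^ 2) * pellPoly (2 * l + 2) + pellPoly (2 * l + 1) := by
  rw [pellPoly, if_neg (by omega)]

lemma aeval_pellPoly_eq {q : ℂ} (hq : q ≠ 0) (l : ℕ) :
    aeval q (pellPoly (2 * l + 1)) = q ^ (2 * l) *
        (chebyshevSeq (pellTrace q) (l + 1) - q ^ 2 * chebyshevSeq (pellTrace q) l) ∧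
      aeval q (pellPoly (2 * l + 2)) =
        (1 + q) * q ^ (2 * l) * chebyshevSeq (pellTrace q) (l + 1) := by
  have hw : q ^ 2 * pellTrace q = 1 + q * (1 + q) ^ 2 + q ^ 4 := by
    unfold pellTrace; field_simp; ring
  induction l with
  | zero => simp [pellPoly, chebyshevSeq]
  | succ l ih =>
    obtain ⟨h1, h2⟩ := ih
    have h3 : aeval q (pellPoly (2 * (l + 1) + 1)) = q ^ (2 * (l + 1)) *
        (chebyshevSeq (pellTrace q) (l + 2) - q ^ 2 * chebyshevSeq (pellTrace q) (l + 1)) := by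
      rw [show 2 * (l + 1) + 1 = 2 * l + 3 by ring, pellPoly_odd_add_two, chebyshevSeq_add_two]
      simp only [map_add, map_mul, map_pow, aeval_X, h1, h2]
      linear_combination (-q ^ (2 * l) * chebyshevSeq (pellTrace q) (l + 1)) * hw
    refine ⟨h3, ?_⟩
    rw [pellPoly_even_add_two]
    simp only [map_add, map_mul, map_pow, map_one, aeval_X, h3]
    rw [show 2 * (l + 1) = 2 * l + 2 by ring, h2]
    ring

lemma aeval_zero_pellPoly (l : ℕ) :
    aeval (0 : ℂ) (pellPoly (2 * l + 1)) = 1 ∧ aeval (0 : ℂ) (pellPoly (2 * l + 2)) = 1 := by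
  induction l with
  | zero => simp [pellPoly]
  | succ l ih =>
    have h : aeval (0 : ℂ) (pellPoly (2 * (l + 1) + 1)) = 1 := by
      rw [show 2 * (l + 1) + 1 = 2 * l + 3 by ring, pellPoly_odd_add_two]
      simp [ih.1]
    refine ⟨h, ?_⟩
    rw [pellPoly_even_add_two]
    simp [h]

lemma isMonicOfDegree_pellPoly (l : ℕ) :
    IsMonicOfDegree (pellPoly (2 * l + 2)) (4 * l + 1) ∧
      IsMonicOfDegree (pellPoly (2 * l + 3)) (4 * l + 3) := by
  have hX : IsMonicOfDegree (1 + X : ℤ[X]) 1 := by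
    rw [add_comm]
    exact (isMonicOfDegree_X ℤ).add_right (by simp)
  have hX2 : IsMonicOfDegree (X + X ^ 2 : ℤ[X]) 2 := by
    rw [add_comm]
    exact (isMonicOfDegree_X_pow ℤ 2).add_right (by simp)
  induction l with
  | zero =>
    have h : IsMonicOfDegree (pellPoly 2) 1 := by simpa [pellPoly] using hX
    refine ⟨h, ?_⟩
    rw [pellPoly_odd_add_two]
    exact (hX2.mul h).add_right (by simp [pellPoly])
  | succ l ih =>
    have h : IsMonicOfDegree (pellPoly (2 * (l + 1) + 2)) (4 * (l + 1) + 1) := by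
      rw [pellPoly_even_add_two, add_comm]
      have h4 := (isMonicOfDegree_X_pow ℤ 4).mul ih.1
      rw [show 4 + (4 * l + 1) = 4 * (l + 1) + 1 by ring] at h4
      refine h4.add_right ?_
      rw [show 2 * (l + 1) + 1 = 2 * l + 3 by ring, (hX.mul ih.2).natDegree_eq]
      omega
    refine ⟨h, ?_⟩
    rw [pellPoly_odd_add_two]
    have h2 := hX2.mul h
    rw [show 2 + (4 * (l + 1) + 1) = 4 * (l + 1) + 3 by ring] at h2
    refine h2.add_right ?_
    rw [show 2 * (l + 1) + 1 = 2 * l + 3 by ring, ih.2.natDegree_eq]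
    omega

lemma isMonicOfDegree_pellPoly_of_two_le {n : ℕ} (hn : 2 ≤ n) :
    IsMonicOfDegree (pellPoly n) (2 * n - 3) := by
  obtain ⟨l, rfl | rfl⟩ : ∃ l, n = 2 * l + 2 ∨ n = 2 * l + 3 := ⟨n / 2 - 1, by omega⟩
  · convert (isMonicOfDegree_pellPoly l).1 using 1; omega
  · convert (isMonicOfDegree_pellPoly l).2 using 1; omega

lemma exists_eq_odd_or_even {n : ℕ} (hn : 1 ≤ n) : ∃ l, n = 2 * l + 1 ∨ n = 2 * l + 2 :=
  ⟨(n - 1) / 2, by omega⟩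

lemma Rsqrt2_lt_one : Rsqrt2 < 1 := Rsqrt2_le.trans_lt (by norm_num)

lemma Rsqrt2_lt_norm_of_aeval_pellPoly {n : ℕ} (hn : 1 ≤ n) {q : ℂ}
    (h : aeval q (pellPoly n) = 0) : Rsqrt2 < ‖q‖ := by
  obtain ⟨l, rfl | rfl⟩ := exists_eq_odd_or_even hn
  all_goals
    have hq : q ≠ 0 := by
      rintro rfl
      simp [aeval_zero_pellPoly] at h
    by_contra! hR
  · rw [(aeval_pellPoly_eq hq l).1, mul_eq_zero, or_iff_right (pow_ne_zero _ hq),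
      sub_eq_zero] at h
    rcases l with _ | l
    · simp [chebyshevSeq] at h
    · exact chebyshevSeq_pellTrace_ne_sq_mul hq hR l h
  · rw [(aeval_pellPoly_eq hq l).2, mul_eq_zero, mul_eq_zero,
      or_iff_left (pow_ne_zero _ hq),
      or_iff_left (chebyshevSeq_pellTrace_ne_zero hq hR l)] at h
    rw [eq_neg_of_add_eq_zero_right h, norm_neg, norm_one] at hR
    exact hR.not_gt Rsqrt2_lt_one

lemma norm_lt_inv_Rsqrt2_of_aeval_pellPoly {n : ℕ} (hn : 1 ≤ n) {q : ℂ}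
    (h : aeval q (pellPoly n) = 0) : ‖q‖ < Rsqrt2⁻¹ := by
  have hq : q ≠ 0 := norm_pos_iff.1 (Rsqrt2_pos.trans (Rsqrt2_lt_norm_of_aeval_pellPoly hn h))
  by_contra! hR'
  have hp : q⁻¹ ≠ 0 := inv_ne_zero hq
  have hR : ‖q⁻¹‖ ≤ Rsqrt2 := by
    rw [norm_inv]
    exact inv_le_of_inv_le₀ Rsqrt2_pos hR'
  obtain ⟨l, rfl | rfl⟩ := exists_eq_odd_or_even hn
  · rw [(aeval_pellPoly_eq hq l).1, mul_eq_zero, or_iff_right (pow_ne_zero _ hq),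
      sub_eq_zero] at h
    rcases l with _ | l
    · simp [chebyshevSeq] at h
    · apply chebyshevSeq_pellTrace_ne_inv_sq_mul hp hR l
      rwa [pellTrace_inv, inv_inv]
  · rw [(aeval_pellPoly_eq hq l).2, mul_eq_zero, mul_eq_zero,
      or_iff_left (pow_ne_zero _ hq), ← pellTrace_inv,
      or_iff_left (chebyshevSeq_pellTrace_ne_zero hp hR l)] at h
    rw [eq_neg_of_add_eq_zero_right h, norm_inv, norm_neg, norm_one, inv_one] at hR
    exact hR.not_gt Rsqrt2_lt_one

theorem pellPoly_roots_in_annulus :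
    (∀ n : ℕ, 1 ≤ n → ∀ q : ℂ, aeval q (pellPoly n) = 0 →
      Rsqrt2 < ‖q‖ ∧ ‖q‖ < Rsqrt2⁻¹) ∧
    (∀ n : ℕ, 2 ≤ n → ∀ q : ℂ, aeval q (reflect (2 * n - 3) (pellPoly n)) = 0 →
      Rsqrt2 < ‖q‖ ∧ ‖q‖ < Rsqrt2⁻¹) := by
  refine ⟨fun n hn q h ↦ ⟨Rsqrt2_lt_norm_of_aeval_pellPoly hn h,
    norm_lt_inv_Rsqrt2_of_aeval_pellPoly hn h⟩, fun n hn q h ↦ ?_⟩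
  have hmonic := isMonicOfDegree_pellPoly_of_two_le hn
  have hq : q ≠ 0 := by
    rintro rfl
    rw [← coeff_zero_eq_aeval_zero', coeff_reflect, revAt_zero, ← hmonic.natDegree_eq,
      coeff_natDegree, hmonic.leadingCoeff_eq] at h
    simp at h
  have hroot : aeval q⁻¹ (pellPoly n) = 0 := by
    let := invertibleOfNonzero (inv_ne_zero hq)
    have := eval₂_reflect_mul_pow (algebraMap ℤ ℂ) q⁻¹ (2 * n - 3) (pellPoly n)
      hmonic.natDegree_eq.le
    rw [invOf_eq_inv, inv_inv, ← aeval_def, ← aeval_def, h, zero_mul] at this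
    exact this.symm
  have h1 := Rsqrt2_lt_norm_of_aeval_pellPoly (by omega) hroot
  have h2 := norm_lt_inv_Rsqrt2_of_aeval_pellPoly (by omega) hroot
  have hpos := norm_pos_iff.2 hq
  rw [norm_inv] at h1 h2
  exact ⟨(inv_lt_inv₀ hpos Rsqrt2_pos).1 h2, (lt_inv_comm₀ Rsqrt2_pos hpos).1 h1⟩
end
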